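/- arXiv:2509.16062 — 9 statements merged into one kernel-verified Lean document; each statement's English description precedes it below -/
import Mathlib

section
/- Let T > 0 and let f : [0,T) → ℝ be right-continuous with f(0) = 0, whose set of discontinuities D ⊂ (0,T) is finite; at each t ∈ D the left limit f(t−) exists with f(t−) > 0 and f(t) = −f(t−); at every point of [0,T) \ D the function f is differentiable with m ≤ f′(t) ≤ M, where 0 < m ≤ M. Then sup_{0 ≤ t < T} |f(t)|² ≤ 2M ∫₀ᵀ (f(t))₊ dt, where (f(t))₊ = max(f(t), 0). -/
open Set MeasureTheory Filter

lemma le_of_deriv_nonpos_off_finset (S : Finset ℝ) : ∀ (h h' : ℝ → ℝ) (a b : ℝ), a ≤ b →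
    ContinuousOn h (Icc a b) →
    (∀ x ∈ Ioo a b, x ∉ S → HasDerivAt h (h' x) x ∧ h' x ≤ 0) → h b ≤ h a := by
  induction S using Finset.induction_on with
  | empty =>
    intro h h' a b hab hc hd
    have : AntitoneOn h (Icc a b) := by
      apply antitoneOn_of_deriv_nonpos (convex_Icc a b) hc
      · intro x hx
        rw [interior_Icc] at hx
        exact (hd x hx (by simp)).1.differentiableAt.differentiableWithinAt
      · intro x hx
        rw [interior_Icc] at hx
        rw [(hd x hx (by simp)).1.deriv]
        exact (hd x hx (by simp)).2
    exact this (left_mem_Icc.2 hab) (right_mem_Icc.2 hab) hab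
  | insert s S hs ih =>
    intro h h' a b hab hc hd
    by_cases hsab : s ∈ Ioo a b
    · have h1 : h s ≤ h a := by
        apply ih h h' a s hsab.1.le (hc.mono (Icc_subset_Icc_right hsab.2.le))
        intro x hx hxS
        refine hd x ⟨hx.1, hx.2.trans hsab.2⟩ ?_
        simp [hxS, hx.2.ne]
      have h2 : h b ≤ h s := by
        apply ih h h' s b hsab.2.le (hc.mono (Icc_subset_Icc_left hsab.1.le))
        intro x hx hxS
        refine hd x ⟨hsab.1.trans hx.1, hx.2⟩ ?_
        simp [hxS, hx.1.ne']
      exact h2.trans h1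
    · apply ih h h' a b hab hc
      intro x hx hxS
      refine hd x hx ?_
      have : x ≠ s := by rintro rfl; exact hsab hx
      simp [hxS, this]

theorem stmt0 (T m M : ℝ) (hT : 0 < T) (hm : 0 < m) (hmM : m ≤ M)
    (f : ℝ → ℝ) (D : Finset ℝ) (hD : (D : Set ℝ) ⊆ Set.Ioo 0 T)
    (hf0 : f 0 = 0)
    (hrc : ∀ t ∈ Set.Ico 0 T, ContinuousWithinAt f (Set.Ici t) t)
    (hjump : ∀ t ∈ D, ∃ L : ℝ, 0 < L ∧
      Filter.Tendsto f (nhdsWithin t (Set.Iio t)) (nhds L) ∧ f t = -L)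
    (hderiv : ∀ t ∈ Set.Ico 0 T \ (D : Set ℝ),
      ∃ d : ℝ, HasDerivWithinAt f d (Set.Ico 0 T) t ∧ m ≤ d ∧ d ≤ M) :
    ∀ t ∈ Set.Ico 0 T, |f t| ^ 2 ≤ 2 * M * ∫ s in (0:ℝ)..T, max (f s) 0 := by
  have hM : 0 < M := hm.trans_le hmM
  have hd : ∀ x : ℝ, ∃ d : ℝ, x ∈ Ioo 0 T → x ∉ D → HasDerivAt f d x ∧ m ≤ d ∧ d ≤ M := by
    intro x
    by_cases hx : x ∈ Ioo 0 T ∧ x ∉ D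
    · obtain ⟨d, h1, h2⟩ := hderiv x ⟨⟨hx.1.1.le, hx.1.2⟩, by simpa using hx.2⟩
      exact ⟨d, fun _ _ => ⟨h1.hasDerivAt (Ico_mem_nhds hx.1.1 hx.1.2), h2⟩⟩
    · exact ⟨0, fun h1 h2 => (hx ⟨h1, h2⟩).elim⟩
  choose f' hf' using hd
  have hg : ContinuousOn (fun x => f x ^ 2) (Ico 0 T) := by
    intro x hx
    by_cases hxD : x ∈ D
    · apply ContinuousAt.continuousWithinAt
      rw [continuousAt_iff_continuous_left'_right']
      obtain ⟨L, hL, h1, h2⟩ := hjump x hxD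
      constructor
      · have := h1.pow 2
        unfold ContinuousWithinAt
        simpa [h2] using this
      · exact ((hrc x hx).mono Ioi_subset_Ici_self).pow 2
    · obtain ⟨d, h1, h2⟩ := hderiv x ⟨hx, by simpa using hxD⟩
      exact h1.continuousWithinAt.pow 2
  -- a bound for f on the interval
  have hbd : ∀ t ∈ Ico 0 T, f t ^ 2 ≤ Real.exp (M * T) := by
    intro t ht
    have key := le_of_deriv_nonpos_off_finset D
      (fun x => Real.exp (-(M * x)) * (1 + f x ^ 2))
      (fun x => Real.exp (-(M * x)) * (-M) * (1 + f x ^ 2)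
        + Real.exp (-(M * x)) * (2 * f x * f' x)) 0 t ht.1 ?_ ?_
    · simp only [hf0, mul_zero, neg_zero, Real.exp_zero] at key
      have h1 : Real.exp (M * t) * (Real.exp (-(M * t)) * (1 + f t ^ 2)) ≤ Real.exp (M * t) * 1 :=
        mul_le_mul_of_nonneg_left (by linarith) (Real.exp_pos _).le
      rw [← mul_assoc, ← Real.exp_add, add_neg_cancel, Real.exp_zero] at h1
      have h2 : Real.exp (M * t) ≤ Real.exp (M * T) :=
        Real.exp_le_exp.2 (mul_le_mul_of_nonneg_left ht.2.le hM.le)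
      linarith
    · exact (Continuous.continuousOn (by fun_prop)).mul
        (continuousOn_const.add (hg.mono (fun x hx => ⟨hx.1, hx.2.trans_lt ht.2⟩)))
    · intro x hx hxD
      obtain ⟨h1, h2, h3⟩ := hf' x ⟨hx.1, hx.2.trans ht.2⟩ hxD
      constructor
      · have e1 : HasDerivAt (fun x : ℝ => Real.exp (-(M * x))) (Real.exp (-(M * x)) * (-M)) x := by
          simpa using (((hasDerivAt_id x).const_mul M).neg).exp
        have e2 : HasDerivAt (fun x => 1 + f x ^ 2) (2 * f x * f' x) x := by
          simpa using (h1.pow 2).const_add 1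
        exact e1.mul e2
      · have : 2 * f x * f' x ≤ M * (1 + f x ^ 2) := by
          rcases le_total (f x) 0 with h | h
          · nlinarith [mul_nonneg (neg_nonneg.2 h) (hm.le.trans h2), mul_nonneg hM.le (sq_nonneg (f x))]
          · nlinarith [mul_le_mul_of_nonneg_left h3 h, mul_nonneg hM.le (sq_nonneg (f x - 1))]
        nlinarith [mul_le_mul_of_nonneg_left this (Real.exp_pos (-(M * x))).le]
  have hcont : ContinuousOn (fun x => max (f x) 0) (Ioo 0 T \ (D : Set ℝ)) := by
    intro x hx
    exact ((hf' x hx.1 (by simpa using hx.2)).1.continuousAt.continuousWithinAt).max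
      continuousWithinAt_const
  have hopen : IsOpen (Ioo 0 T \ (D : Set ℝ)) := isOpen_Ioo.sdiff D.finite_toSet.isClosed
  have hint : IntegrableOn (fun x => max (f x) 0) (Ioo 0 T \ (D : Set ℝ)) := by
    refine IntegrableOn.of_bound ?_
      (hcont.aestronglyMeasurable hopen.measurableSet) (1 + Real.exp (M * T)) ?_
    · exact ((measure_mono sdiff_subset).trans_lt (by simp))
    · filter_upwards [ae_restrict_mem hopen.measurableSet] with x hx
      have := hbd x ⟨hx.1.1.le, hx.1.2⟩
      rw [Real.norm_eq_abs, abs_of_nonneg (le_max_right _ _)]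
      refine max_le ?_ (by positivity)
      nlinarith [sq_nonneg (f x - 1), sq_nonneg (f x)]
  have hII : IntervalIntegrable (fun x => max (f x) 0) volume 0 T := by
    rw [intervalIntegrable_iff_integrableOn_Ioo_of_le hT.le]
    refine hint.congr_set_ae ?_
    exact (sdiff_null_ae_eq_self (D.finite_toSet.measure_zero volume)).symm
  intro t ht
  have hIt : IntervalIntegrable (fun x => max (f x) 0) volume 0 t :=
    hII.mono_set (by rw [uIcc_of_le ht.1, uIcc_of_le hT.le]; exact Icc_subset_Icc_right ht.2.le)
  have key := le_of_deriv_nonpos_off_finset D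
      (fun x => f x ^ 2 - 2 * M * ∫ s in (0:ℝ)..x, max (f s) 0)
      (fun x => 2 * f x * f' x - 2 * M * max (f x) 0) 0 t ht.1 ?_ ?_
  · simp only [hf0, intervalIntegral.integral_same] at key
    have hmono : ∫ s in (0:ℝ)..t, max (f s) 0 ≤ ∫ s in (0:ℝ)..T, max (f s) 0 :=
      intervalIntegral.integral_mono_interval le_rfl ht.1 ht.2.le
        (Eventually.of_forall fun x => le_max_right _ _) hII
    rw [sq_abs]
    nlinarith [mul_le_mul_of_nonneg_left hmono hM.le]
  · refine (hg.mono (fun x hx => ⟨hx.1, hx.2.trans_lt ht.2⟩)).sub (continuousOn_const.mul ?_)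
    have := intervalIntegral.continuousOn_primitive_interval' hIt left_mem_uIcc
    rwa [uIcc_of_le ht.1] at this
  · intro x hx hxD
    have hx' : x ∈ Ioo 0 T := ⟨hx.1, hx.2.trans ht.2⟩
    obtain ⟨h1, h2, h3⟩ := hf' x hx' hxD
    constructor
    · have e1 : HasDerivAt (fun x => f x ^ 2) (2 * f x * f' x) x := by
        have := h1.pow 2
        simp only [Nat.cast_ofNat, Nat.add_one_sub_one, pow_one] at this
        exact this
      refine e1.sub (HasDerivAt.const_mul (2 * M) ?_)
      refine intervalIntegral.integral_hasDerivAt_right ?_ ?_ ?_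
      · exact hII.mono_set (by
          rw [uIcc_of_le hx.1.le, uIcc_of_le hT.le]; exact Icc_subset_Icc_right hx'.2.le)
      · exact hcont.stronglyMeasurableAtFilter hopen x ⟨hx', by simpa using hxD⟩
      · exact h1.continuousAt.max continuousAt_const
    · rcases le_total (f x) 0 with h | h
      · rw [max_eq_right h]
        nlinarith [mul_nonneg (neg_nonneg.2 h) (hm.le.trans h2)]
      · rw [max_eq_left h]
        nlinarith [mul_le_mul_of_nonneg_left h3 h]
end

section
/- Let T > 0 and let f : [0,T) → ℝ be right-continuous with f(0) = 0, whose set of discontinuities D ⊂ (0,T) is finite; at each t ∈ D the left limit f(t−) exists with f(t−) > 0 and f(t) = −f(t−); at every point of [0,T) \ D the function f is differentiable with m ≤ f′(t) ≤ M, where 0 < m ≤ M. Then ∫₀ᵀ |f(t)| dt ≤ (1 + M/m) ∫₀ᵀ (f(t))₊ dt. -/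
open Set MeasureTheory Filter

theorem stmt1 (T m M : ℝ) (hT : 0 < T) (hm : 0 < m) (hmM : m ≤ M)
    (f : ℝ → ℝ) (D : Finset ℝ) (hD : (D : Set ℝ) ⊆ Set.Ioo 0 T)
    (hf0 : f 0 = 0)
    (hrc : ∀ t ∈ Set.Ico 0 T, ContinuousWithinAt f (Set.Ici t) t)
    (hjump : ∀ t ∈ D, ∃ L : ℝ, 0 < L ∧
      Filter.Tendsto f (nhdsWithin t (Set.Iio t)) (nhds L) ∧ f t = -L)
    (hderiv : ∀ t ∈ Set.Ico 0 T \ (D : Set ℝ),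
      ∃ d : ℝ, HasDerivWithinAt f d (Set.Ico 0 T) t ∧ m ≤ d ∧ d ≤ M) :
    (∫ s in (0:ℝ)..T, |f s|) ≤ (1 + M / m) * ∫ s in (0:ℝ)..T, max (f s) 0 := by
  have hM : 0 < M := hm.trans_le hmM
  by_cases hint : IntervalIntegrable (fun s => |f s|) volume 0 T
  swap
  · rw [intervalIntegral.integral_undef hint]
    have : 0 ≤ ∫ s in (0:ℝ)..T, max (f s) 0 :=
      intervalIntegral.integral_nonneg hT.le (fun s _ => le_max_right _ _)
    positivity
  -- derivative at interior points
  have hd : ∀ t ∈ Ioo 0 T \ (D : Set ℝ), ∃ d : ℝ, HasDerivAt f d t ∧ m ≤ d ∧ d ≤ M := by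
    rintro t ⟨ht, htD⟩
    obtain ⟨d, h1, h2⟩ := hderiv t ⟨⟨ht.1.le, ht.2⟩, htD⟩
    exact ⟨d, h1.hasDerivAt (Ico_mem_nhds ht.1 ht.2), h2⟩
  have hDnull : volume (D : Set ℝ) = 0 := D.finite_toSet.measure_zero _
  have hmeas : AEStronglyMeasurable f (volume.restrict (Ioc 0 T)) := by
    have h1 : ContinuousOn f (Ioo 0 T \ (D : Set ℝ)) := by
      intro t ht
      obtain ⟨d, h, _⟩ := hd t ht
      exact h.continuousAt.continuousWithinAt
    have h2 := h1.aestronglyMeasurable (μ := volume)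
      (measurableSet_Ioo.diff D.measurableSet)
    have h3 : (Ioo 0 T \ (D : Set ℝ) : Set ℝ) =ᵐ[volume] Ioc 0 T :=
      (sdiff_null_ae_eq_self hDnull).trans Ioo_ae_eq_Ioc
    rwa [Measure.restrict_congr_set h3] at h2
  have hfint : IntervalIntegrable f volume 0 T := by
    rw [intervalIntegrable_iff_integrableOn_Ioc_of_le hT.le] at hint ⊢
    exact (integrable_norm_iff hmeas).1 hint
  have hpint : IntervalIntegrable (fun s => max (f s) 0) volume 0 T := by
    rw [intervalIntegrable_iff_integrableOn_Ioc_of_le hT.le] at hfint ⊢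
    exact hfint.pos_part
  set φ : ℝ → ℝ := fun s => 2 * (M + m) * max (f s) 0 - 2 * m * |f s| with hφ
  have hφint : IntervalIntegrable φ volume 0 T :=
    (hpint.const_mul _).sub (hint.const_mul _)
  have hgc : ContinuousOn (fun s => f s ^ 2) (Ico 0 T) := by
    intro t ht
    by_cases htD : t ∈ D
    · obtain ⟨L, hL, h1, h2⟩ := hjump t htD
      apply ContinuousAt.continuousWithinAt
      rw [continuousAt_iff_continuous_left'_right']
      constructor
      · have := h1.pow 2
        simp only [ContinuousWithinAt, h2, neg_sq]
        exact this
      · exact ((hrc t ht).mono Ioi_subset_Ici_self).pow 2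
    · obtain ⟨d, h, _⟩ := hderiv t ⟨ht, htD⟩
      exact h.continuousWithinAt.pow 2
  have hg' : ∀ s ∈ Ioo 0 T \ (D : Set ℝ), HasDerivAt (fun s => f s ^ 2)
      (deriv (fun s => f s ^ 2) s) s ∧ deriv (fun s => f s ^ 2) s ≤ φ s ∧
      |deriv (fun s => f s ^ 2) s| ≤ 2 * M * |f s| := by
    intro s hs
    obtain ⟨d, h, h1, h2⟩ := hd s hs
    have h3 : HasDerivAt (fun s => f s ^ 2) (2 * f s * d) s := by
      have h4 := h.fun_pow 2
      have h5 : ((2 : ℕ) : ℝ) * f s ^ (2 - 1) * d = 2 * f s * d := by norm_num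
      rw [← h5]
      exact h4
    rw [h3.deriv]
    refine ⟨h3, ?_, ?_⟩
    · simp only [hφ]
      rcases le_total 0 (f s) with h0 | h0
      · rw [max_eq_left h0, abs_of_nonneg h0]; nlinarith
      · rw [max_eq_right h0, abs_of_nonpos h0]; nlinarith
    · rw [abs_mul, abs_mul, abs_two, abs_of_pos (hm.trans_le h1)]
      nlinarith [abs_nonneg (f s)]
  have key : ∀ t ∈ Ioo 0 T, 0 ≤ ∫ s in (0:ℝ)..t, φ s := by
    intro t ht
    have hc : ContinuousOn (fun s => f s ^ 2) (Icc 0 t) :=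
      hgc.mono (Icc_subset_Ico_right ht.2)
    obtain ⟨C, hC⟩ := isCompact_Icc.exists_bound_of_continuousOn hc
    have hae : ∀ᵐ s ∂(volume.restrict (Ioc 0 t)), s ∈ Ioc 0 t ∧ s ∉ (D : Set ℝ) := by
      refine (ae_restrict_mem measurableSet_Ioc).and (ae_restrict_of_ae ?_)
      exact measure_eq_zero_iff_ae_notMem.1 hDnull
    have hdi : IntervalIntegrable (deriv (fun s => f s ^ 2)) volume 0 t := by
      rw [intervalIntegrable_iff_integrableOn_Ioc_of_le ht.1.le]
      refine Measure.integrableOn_of_bounded (M := 2 * M * (C + 1)) (by simp)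
        (measurable_deriv _).aestronglyMeasurable ?_
      filter_upwards [hae] with s hs
      have h1 := (hg' s ⟨⟨hs.1.1, hs.1.2.trans_lt ht.2⟩, hs.2⟩).2.2
      have h2 := hC s ⟨hs.1.1.le, hs.1.2⟩
      rw [Real.norm_eq_abs, abs_of_nonneg (sq_nonneg _)] at h2
      have h3 : |f s| ≤ C + 1 := by
        nlinarith [sq_abs (f s), sq_nonneg (|f s| - 1), abs_nonneg (f s)]
      rw [Real.norm_eq_abs]
      exact h1.trans (by gcongr)
    have hftc := integral_eq_of_hasDerivAt_off_countable_of_le (fun s => f s ^ 2)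
      (deriv (fun s => f s ^ 2)) ht.1.le D.countable_toSet hc
      (fun x hx => (hg' x ⟨⟨hx.1.1, hx.1.2.trans ht.2⟩, hx.2⟩).1) hdi
    have hφt : IntervalIntegrable φ volume 0 t :=
      hφint.mono_set (by rw [uIcc_of_le ht.1.le, uIcc_of_le hT.le]; exact Icc_subset_Icc_right ht.2.le)
    have hle : ∫ s in (0:ℝ)..t, deriv (fun s => f s ^ 2) s ≤ ∫ s in (0:ℝ)..t, φ s := by
      rw [intervalIntegral.integral_of_le ht.1.le, intervalIntegral.integral_of_le ht.1.le]
      rw [intervalIntegrable_iff_integrableOn_Ioc_of_le ht.1.le] at hφt hdi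
      refine integral_mono_ae hdi hφt ?_
      filter_upwards [hae] with s hs
      exact (hg' s ⟨⟨hs.1.1, hs.1.2.trans_lt ht.2⟩, hs.2⟩).2.1
    rw [hftc] at hle
    simp only [hf0] at hle
    nlinarith [sq_nonneg (f t)]
  have hfin : 0 ≤ ∫ s in (0:ℝ)..T, φ s := by
    have hcont : ContinuousOn (fun t => ∫ s in (0:ℝ)..t, φ s) (Icc 0 T) := by
      have := intervalIntegral.continuousOn_primitive_interval' hφint left_mem_uIcc
      rwa [uIcc_of_le hT.le] at this
    have h1 := (hcont T ⟨hT.le, le_rfl⟩).mono (Ioo_subset_Icc_self)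
    haveI : (nhdsWithin T (Ioo 0 T)).NeBot := by
      rw [← mem_closure_iff_nhdsWithin_neBot, closure_Ioo hT.ne]
      exact ⟨hT.le, le_rfl⟩
    exact ge_of_tendsto h1 (eventually_mem_nhdsWithin.mono key)
  have hsplit : ∫ s in (0:ℝ)..T, φ s = 2 * (M + m) * (∫ s in (0:ℝ)..T, max (f s) 0)
      - 2 * m * ∫ s in (0:ℝ)..T, |f s| := by
    rw [hφ, intervalIntegral.integral_sub (hpint.const_mul _) (hint.const_mul _),
      intervalIntegral.integral_const_mul, intervalIntegral.integral_const_mul]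
  rw [hsplit] at hfin
  have : (1 + M / m) = (M + m) / m := by field_simp; ring
  rw [this, div_mul_eq_mul_div, le_div_iff₀ hm]
  linarith
end

section
/- Let T > 0 and let f : [0,T) → ℝ be right-continuous with f(0) = 0, whose set of discontinuities D ⊂ (0,T) is finite; at each t ∈ D the left limit f(t−) exists with f(t−) > 0 and f(t) = −f(t−); at every point of [0,T) \ D the function f is differentiable with m ≤ f′(t) ≤ M, where 0 < m ≤ M. Let N_T denote the cardinality of D. Then (m²/(2M)) · (1 + M/m)⁻¹ · T²/(1 + N_T) ≤ ∫₀ᵀ |f(t)| dt. -/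
open Set MeasureTheory Filter

theorem base_piece (m M a b : ℝ) (hab : a < b) (hm : 0 < m) (hmM : m ≤ M) (f : ℝ → ℝ)
    (h : ∀ x y, a ≤ x → x ≤ y → y < b → m * (y - x) ≤ f y - f x ∧ f y - f x ≤ M * (y - x)) :
    IntervalIntegrable (fun s => |f s|) volume a b ∧ m / 4 * (b - a) ^ 2 ≤ ∫ s in a..b, |f s| := by
  have hM : 0 ≤ M := by linarith
  have hL : LipschitzOnWith (Real.toNNReal M) f (Ico a b) := by
    apply LipschitzOnWith.of_dist_le_mul
    intro x hx y hy
    rw [Real.coe_toNNReal _ hM, Real.dist_eq, Real.dist_eq]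
    rcases le_total x y with hxy | hxy
    · obtain ⟨h1, h2⟩ := h x y hx.1 hxy hy.2
      have : 0 ≤ m * (y - x) := mul_nonneg hm.le (by linarith)
      rw [abs_of_nonpos (by linarith), abs_of_nonpos (by linarith)]
      linarith
    · obtain ⟨h1, h2⟩ := h y x hy.1 hxy hx.2
      have : 0 ≤ m * (x - y) := mul_nonneg hm.le (by linarith)
      rw [abs_of_nonneg (by linarith), abs_of_nonneg (by linarith)]
      linarith
  obtain ⟨g, hg, hfg⟩ := hL.extend_real
  have hgc : Continuous g := hg.continuous
  have hae : ∀ᵐ s ∂volume, s ∈ uIoc a b → |g s| = |f s| := by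
    have : ∀ᵐ s : ℝ ∂volume, s ≠ b := by simp [ae_iff]
    filter_upwards [this] with s hs hs'
    rw [uIoc_of_le hab.le] at hs'
    rw [hfg ⟨hs'.1.le, lt_of_le_of_ne hs'.2 hs⟩]
  have hgi : ∀ u v, IntervalIntegrable (fun s => |g s|) volume u v :=
    fun u v => hgc.abs.intervalIntegrable u v
  refine ⟨(hgi a b).congr_ae ((ae_restrict_iff' measurableSet_uIoc).2 hae), ?_⟩
  rw [← intervalIntegral.integral_congr_ae hae]
  set k := (b - a) / 2 with hk
  have e1 : ∫ s in a..b, |g s| = (∫ s in a..(a+k), |g s|) + ∫ s in a..(a+k), |g (s + k)| := by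
    rw [intervalIntegral.integral_comp_add_right (fun s => |g s|) k,
      show a + k + k = b by rw [hk]; ring,
      intervalIntegral.integral_add_adjacent_intervals (hgi _ _) (hgi _ _)]
  have hi2 : IntervalIntegrable (fun s => |g (s + k)|) volume a (a+k) :=
    Continuous.intervalIntegrable (by fun_prop) _ _
  rw [e1, ← intervalIntegral.integral_add (hgi _ _) hi2]
  have e2 : m / 4 * (b - a) ^ 2 = ∫ s in a..(a+k), m * k := by
    rw [intervalIntegral.integral_const, smul_eq_mul, hk]; ring
  rw [e2]
  have hk0 : 0 < k := by rw [hk]; linarith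
  refine intervalIntegral.integral_mono_on_of_le_Ioo (by linarith) (by simp) ((hgi _ _).add hi2) ?_
  intro s hs
  have hsb : s + k < b := by have := hs.2; rw [hk] at *; linarith
  have h1 := (h s (s + k) hs.1.le (by linarith) hsb).1
  rw [← hfg ⟨hs.1.le, by linarith⟩, ← hfg ⟨by linarith [hs.1], hsb⟩]
  have := le_abs_self (f (s+k))
  have := neg_abs_le (f s)
  have : m * (s + k - s) = m * k := by ring
  linarith

theorem all_pieces (m M : ℝ) (hm : 0 < m) (hmM : m ≤ M) (f : ℝ → ℝ) (a : ℝ) (D : Finset ℝ) :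
    ∀ b, a < b → (∀ t ∈ D, a < t ∧ t < b) →
    (∀ x y, a ≤ x → x ≤ y → y < b → (∀ t ∈ D, ¬ (x < t ∧ t ≤ y)) →
      m * (y - x) ≤ f y - f x ∧ f y - f x ≤ M * (y - x)) →
    IntervalIntegrable (fun s => |f s|) volume a b ∧
      m / 4 * ((b - a) ^ 2 / (1 + (D.card : ℝ))) ≤ ∫ s in a..b, |f s| := by
  induction D using Finset.induction_on_max with
  | empty =>
    intro b hab _ h
    have := base_piece m M a b hab hm hmM f (fun x y h1 h2 h3 => h x y h1 h2 h3 (by simp))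
    simpa using this
  | insert d D hd ih =>
    intro b hab hD h
    have hdD : d ∉ D := fun hh => lt_irrefl _ (hd d hh)
    obtain ⟨had, hdb⟩ := hD d (by simp)
    obtain ⟨i1, b1⟩ := ih d had
      (fun t ht => ⟨(hD t (by simp [ht])).1, hd t ht⟩)
      (fun x y h1 h2 h3 h4 => h x y h1 h2 (by linarith) (by
        intro t ht hh
        rcases Finset.mem_insert.1 ht with rfl | ht
        · linarith [hh.2]
        · exact h4 t ht hh))
    obtain ⟨i2, b2⟩ := base_piece m M d b hdb hm hmM f
      (fun x y h1 h2 h3 => h x y (by linarith) h2 h3 (by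
        intro t ht hh
        rcases Finset.mem_insert.1 ht with rfl | ht
        · linarith [hh.1]
        · linarith [hh.1, hd t ht]))
    refine ⟨i1.trans i2, ?_⟩
    rw [← intervalIntegral.integral_add_adjacent_intervals i1 i2, Finset.card_insert_of_notMem hdD]
    refine le_trans ?_ (add_le_add b1 b2)
    rw [← mul_add]
    refine mul_le_mul_of_nonneg_left ?_ (by linarith)
    push_cast
    have hn : (0:ℝ) < 1 + (D.card : ℝ) := by positivity
    generalize (D.card : ℝ) = n at *
    rw [div_add' _ _ _ hn.ne', div_le_div_iff₀ (by linarith) hn]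
    nlinarith [sq_nonneg ((d - a) - (1 + n) * (b - d))]

theorem stmt2 (T m M : ℝ) (hT : 0 < T) (hm : 0 < m) (hmM : m ≤ M)
    (f : ℝ → ℝ) (D : Finset ℝ) (hD : (D : Set ℝ) ⊆ Set.Ioo 0 T)
    (hf0 : f 0 = 0)
    (hrc : ∀ t ∈ Set.Ico 0 T, ContinuousWithinAt f (Set.Ici t) t)
    (hjump : ∀ t ∈ D, ∃ L : ℝ, 0 < L ∧
      Filter.Tendsto f (nhdsWithin t (Set.Iio t)) (nhds L) ∧ f t = -L)
    (hderiv : ∀ t ∈ Set.Ico 0 T \ (D : Set ℝ),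
      ∃ d : ℝ, HasDerivWithinAt f d (Set.Ico 0 T) t ∧ m ≤ d ∧ d ≤ M) :
    (m ^ 2 / (2 * M)) * (1 + M / m)⁻¹ * (T ^ 2 / (1 + (D.card : ℝ))) ≤
      ∫ s in (0:ℝ)..T, |f s| := by
  have key := (all_pieces m M hm hmM f 0 D T hT (fun t ht => hD ht) (by
    intro x y hx hxy hy hno
    have hda : ∀ t, x < t → t ≤ y → ∃ d : ℝ, HasDerivAt f d t ∧ m ≤ d ∧ d ≤ M := by
      intro t h1 h2
      obtain ⟨d, hd, hd'⟩ := hderiv t ⟨⟨by linarith, by linarith⟩, fun ht => hno t ht ⟨h1, h2⟩⟩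
      exact ⟨d, hd.hasDerivAt (Ico_mem_nhds (by linarith) (by linarith)), hd'⟩
    have hc : ContinuousOn f (Icc x y) := by
      intro t ht
      rcases eq_or_lt_of_le ht.1 with rfl | h1
      · exact (hrc x ⟨hx, by linarith⟩).mono Icc_subset_Ici_self
      · obtain ⟨d, hd, _⟩ := hda t h1 ht.2
        exact hd.continuousAt.continuousWithinAt
    have hdiff : DifferentiableOn ℝ f (interior (Icc x y)) := by
      rw [interior_Icc]
      intro t ht
      obtain ⟨d, hd, _⟩ := hda t ht.1 ht.2.le
      exact hd.differentiableAt.differentiableWithinAt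
    constructor
    · refine (convex_Icc x y).mul_sub_le_image_sub_of_le_deriv hc hdiff ?_ x
        (left_mem_Icc.2 hxy) y (right_mem_Icc.2 hxy) hxy
      rw [interior_Icc]
      intro t ht
      obtain ⟨d, hd, h1, h2⟩ := hda t ht.1 ht.2.le
      rwa [hd.deriv]
    · refine (convex_Icc x y).image_sub_le_mul_sub_of_deriv_le hc hdiff ?_ x
        (left_mem_Icc.2 hxy) y (right_mem_Icc.2 hxy) hxy
      rw [interior_Icc]
      intro t ht
      obtain ⟨d, hd, h1, h2⟩ := hda t ht.1 ht.2.le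
      rwa [hd.deriv])).2
  refine le_trans ?_ key
  rw [sub_zero]
  refine mul_le_mul_of_nonneg_right ?_ (by positivity)
  have hM : 0 < M := by linarith
  have e : (m ^ 2 / (2 * M)) * (1 + M / m)⁻¹ = m ^ 3 / (2 * M * (m + M)) := by
    field_simp
  rw [e, div_le_div_iff₀ (by positivity) (by norm_num)]
  have h1 : m * m ≤ M * m := mul_le_mul_of_nonneg_right hmM hm.le
  have h2 : M * m ≤ M * M := mul_le_mul_of_nonneg_left hmM hM.le
  nlinarith [mul_le_mul_of_nonneg_left (show 4 * (m * m) ≤ 2 * M * (m + M) by nlinarith) hm.le]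
end

section
/- Let λ : [0,∞) → ℝ be continuous, nondecreasing, and integrable on every bounded interval, and suppose λ(t*) = 0 for some t* ≥ 0. Define Λ(t) = ∫₀ᵗ λ(s) ds and Λ⁺(t) = ∫₀ᵗ max(λ(s),0) ds. Then for every ε ∈ (0,1), ∫₀^∞ exp(Λ(t)) · ε⁻¹ · max(λ(t),0) · exp(−ε⁻¹·Λ⁺(t)) dt ≤ exp(Λ(t*))/(1 − ε). -/
open Set MeasureTheory Filter

theorem stmt7_aux (l : ℝ → ℝ) (hc : Continuous l) (hm : Monotone l)
    (a : ℝ) (ha : 0 ≤ a) (hz : l a = 0) (ε : ℝ) (h0 : 0 < ε) (h1 : ε < 1) :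
      (∫ t in Set.Ioi (0:ℝ),
        Real.exp (∫ s in (0:ℝ)..t, l s) * ε⁻¹ * max (l t) 0 *
          Real.exp (-ε⁻¹ * ∫ s in (0:ℝ)..t, max (l s) 0)) ≤
        Real.exp (∫ s in (0:ℝ)..a, l s) / (1 - ε) := by
  have hp : Continuous fun t => max (l t) 0 := hc.max continuous_const
  have hε : (0:ℝ) < 1 - ε := by linarith
  set C := ∫ s in (0:ℝ)..a, l s with hC
  set P : ℝ → ℝ := fun t => ∫ s in (0:ℝ)..t, max (l s) 0 with hP
  have key : ∀ t, a ≤ t → (∫ s in (0:ℝ)..t, l s) = C + P t := by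
    intro t ht
    have e1 := intervalIntegral.integral_add_adjacent_intervals
      (hc.intervalIntegrable (μ := volume) 0 a) (hc.intervalIntegrable a t)
    have e2 := intervalIntegral.integral_add_adjacent_intervals
      (hp.intervalIntegrable (μ := volume) 0 a) (hp.intervalIntegrable a t)
    have e3 : (∫ s in (0:ℝ)..a, max (l s) 0) = ∫ s in (0:ℝ)..a, (0:ℝ) := by
      apply intervalIntegral.integral_congr
      intro s hs
      rw [uIcc_of_le ha] at hs
      exact max_eq_right (hz ▸ hm hs.2)
    have e4 : (∫ s in a..t, max (l s) 0) = ∫ s in a..t, l s := by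
      apply intervalIntegral.integral_congr
      intro s hs
      rw [uIcc_of_le ht] at hs
      exact max_eq_left (hz ▸ hm hs.1)
    simp only [intervalIntegral.integral_zero] at e3
    simp only [hP, hC]
    linarith
  have hcongr : (∫ t in Set.Ioi (0:ℝ),
        Real.exp (∫ s in (0:ℝ)..t, l s) * ε⁻¹ * max (l t) 0 * Real.exp (-ε⁻¹ * P t))
      = ∫ t in Set.Ioi (0:ℝ), Real.exp C * ε⁻¹ * max (l t) 0 *
          Real.exp (-(ε⁻¹ - 1) * P t) := by
    congr 1
    funext t
    rcases le_total a t with h | h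
    · rw [key t h, Real.exp_add, show -(ε⁻¹ - 1) * P t = P t + -ε⁻¹ * P t by ring, Real.exp_add]
      ring
    · rw [max_eq_right (hz ▸ hm h : l t ≤ 0)]
      simp
  rw [hcongr]
  by_cases hI : IntegrableOn (fun t => Real.exp C * ε⁻¹ * max (l t) 0 *
          Real.exp (-(ε⁻¹ - 1) * P t)) (Ioi 0)
  swap
  · rw [integral_undef hI]; positivity
  refine le_of_tendsto (intervalIntegral_tendsto_integral_Ioi 0 hI tendsto_id) ?_
  refine Eventually.of_forall fun T => ?_
  have hPd : ∀ t, HasDerivAt P (max (l t) 0) t := fun t =>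
    intervalIntegral.integral_hasDerivAt_right (hp.intervalIntegrable 0 t)
      hp.aestronglyMeasurable.stronglyMeasurableAtFilter hp.continuousAt
  have hPc : Continuous P := continuous_iff_continuousAt.2 fun t => (hPd t).continuousAt
  have hG : ∀ t, HasDerivAt (fun t => -(Real.exp C / (1 - ε)) * Real.exp (-(ε⁻¹ - 1) * P t))
      (Real.exp C * ε⁻¹ * max (l t) 0 * Real.exp (-(ε⁻¹ - 1) * P t)) t := by
    intro t
    have hd := ((hPd t).const_mul (-(ε⁻¹ - 1))).exp.const_mul (-(Real.exp C / (1 - ε)))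
    have hk : Real.exp C * ε⁻¹ = Real.exp C / (1 - ε) * (ε⁻¹ - 1) := by
      have h2 : (1 - ε) ≠ 0 := hε.ne'
      field_simp
    refine hd.congr_deriv ?_
    rw [hk]
    ring
  have hF := intervalIntegral.integral_eq_sub_of_hasDerivAt (a := 0) (b := T) (fun t _ => hG t)
    (Continuous.intervalIntegrable (by fun_prop) _ _)
  simp only [id]
  rw [hF]
  have hP0 : P 0 = 0 := by simp [hP]
  rw [hP0]
  have : 0 ≤ Real.exp C / (1 - ε) * Real.exp (-(ε⁻¹ - 1) * P T) := by positivity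
  simp only [mul_zero, Real.exp_zero]
  linarith

theorem stmt7 (lam : ℝ → ℝ) (hcont : ContinuousOn lam (Set.Ici 0))
    (hmono : MonotoneOn lam (Set.Ici 0))
    (hint : ∀ T : ℝ, MeasureTheory.IntegrableOn lam (Set.Icc 0 T))
    (tstar : ℝ) (htstar : 0 ≤ tstar) (hzero : lam tstar = 0) :
    ∀ ε : ℝ, 0 < ε → ε < 1 →
      (∫ t in Set.Ioi (0:ℝ),
        Real.exp (∫ s in (0:ℝ)..t, lam s) * ε⁻¹ * max (lam t) 0 *
          Real.exp (-ε⁻¹ * ∫ s in (0:ℝ)..t, max (lam s) 0)) ≤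
        Real.exp (∫ s in (0:ℝ)..tstar, lam s) / (1 - ε) := by
  intro ε h0 h1
  have hc : Continuous fun t => lam (max t 0) :=
    hcont.comp_continuous (by fun_prop) fun t => le_max_right t 0
  have hm : Monotone fun t => lam (max t 0) := fun x y h =>
    hmono (le_max_right x 0) (le_max_right y 0) (max_le_max_right 0 h)
  have main := stmt7_aux _ hc hm tstar htstar (by simp [htstar, hzero]) ε h0 h1
  have e1 : ∀ t : ℝ, 0 ≤ t → (∫ s in (0:ℝ)..t, lam (max s 0)) = ∫ s in (0:ℝ)..t, lam s := by
    intro t ht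
    apply intervalIntegral.integral_congr
    intro s hs
    rw [uIcc_of_le ht] at hs
    simp only [max_eq_left hs.1]
  have e2 : ∀ t : ℝ, 0 ≤ t →
      (∫ s in (0:ℝ)..t, max (lam (max s 0)) 0) = ∫ s in (0:ℝ)..t, max (lam s) 0 := by
    intro t ht
    apply intervalIntegral.integral_congr
    intro s hs
    rw [uIcc_of_le ht] at hs
    simp only [max_eq_left hs.1]
  rw [e1 tstar htstar] at main
  refine le_of_eq_of_le ?_ main
  apply setIntegral_congr_fun measurableSet_Ioi
  intro t ht
  have ht' : (0:ℝ) ≤ t := le_of_lt ht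
  simp only [e1 t ht', e2 t ht', max_eq_left ht']
end

section
/- Let U : ℝᴺ → ℝ be twice continuously differentiable, let x, v ∈ ℝᴺ with v ≠ 0, and define λ(t) = ⟨v, ∇U(x + t v)⟩. Suppose λ(0) < 0, that t* > 0 satisfies λ(t*) = 0, and that there exist constants 0 < κ₁ ≤ κ₂ such that κ₁‖v‖² ≤ ⟨v, ∇²U(x + t v) v⟩ ≤ κ₂‖v‖² for all t ∈ [0, t*]. Then: (a) t* ≥ −λ(0)/(κ₂‖v‖²); (b) for every t ∈ [0, t*], U(x + t v) − U(x) ≤ −(κ₁/2)‖v‖² t²; and (c) U(x + t* v) − U(x) ≤ −(κ₁/(2κ₂²)) · λ(0)²/‖v‖². -/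
open Set
open scoped RealInnerProductSpace

theorem stmt8 (N : ℕ) (U : EuclideanSpace ℝ (Fin N) → ℝ) (hU : ContDiff ℝ 2 U)
    (x v : EuclideanSpace ℝ (Fin N)) (hv : v ≠ 0)
    (κ₁ κ₂ : ℝ) (hκ₁ : 0 < κ₁) (hκ : κ₁ ≤ κ₂)
    (tstar : ℝ) (htstar : 0 < tstar)
    (hlam0 : ⟪v, gradient U x⟫ < 0)
    (hlamstar : ⟪v, gradient U (x + tstar • v)⟫ = 0)
    (hhess : ∀ t ∈ Set.Icc 0 tstar,
      κ₁ * ‖v‖ ^ 2 ≤ ⟪v, fderiv ℝ (gradient U) (x + t • v) v⟫ ∧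
      ⟪v, fderiv ℝ (gradient U) (x + t • v) v⟫ ≤ κ₂ * ‖v‖ ^ 2) :
    -(⟪v, gradient U x⟫) / (κ₂ * ‖v‖ ^ 2) ≤ tstar ∧
    (∀ t ∈ Set.Icc 0 tstar, U (x + t • v) - U x ≤ -(κ₁ / 2) * ‖v‖ ^ 2 * t ^ 2) ∧
    U (x + tstar • v) - U x ≤ -(κ₁ / (2 * κ₂ ^ 2)) * ⟪v, gradient U x⟫ ^ 2 / ‖v‖ ^ 2 := by
  have hn : 0 < ‖v‖ ^ 2 := by have := norm_pos_iff.mpr hv; positivity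
  have hκ₂ : 0 < κ₂ := lt_of_lt_of_le hκ₁ hκ
  have hline : ∀ t : ℝ, HasDerivAt (fun s : ℝ => x + s • v) v t := by
    intro t
    simpa using ((hasDerivAt_id t).smul_const v).const_add x
  have hUd : Differentiable ℝ U := hU.differentiable (by norm_num)
  have hgd : Differentiable ℝ (gradient U) := by
    have h1 : Differentiable ℝ (fderiv ℝ U) :=
      (hU.fderiv_right (m := 1) (by norm_num)).differentiable (by norm_num)
    exact (InnerProductSpace.toDual ℝ
      (EuclideanSpace ℝ (Fin N))).symm.toContinuousLinearEquiv.differentiable.comp h1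
  have hU' : ∀ t : ℝ, HasDerivAt (fun s : ℝ => U (x + s • v)) ⟪v, gradient U (x + t • v)⟫ t := by
    intro t
    have h := (hUd (x + t • v)).hasGradientAt.hasFDerivAt.comp_hasDerivAt t (hline t)
    rw [InnerProductSpace.toDual_apply_apply, real_inner_comm] at h
    exact h
  have hl' : ∀ t : ℝ, HasDerivAt (fun s : ℝ => ⟪v, gradient U (x + s • v)⟫)
      ⟪v, fderiv ℝ (gradient U) (x + t • v) v⟫ t := by
    intro t
    have h := (hgd (x + t • v)).hasFDerivAt.comp_hasDerivAt t (hline t)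
    have h2 := (innerSL ℝ v).hasFDerivAt.comp_hasDerivAt t h
    exact h2
  have key : ∀ f f' : ℝ → ℝ, (∀ t, HasDerivAt f (f' t) t) →
      (∀ t ∈ Icc 0 tstar, 0 ≤ f' t) → MonotoneOn f (Icc 0 tstar) := by
    intro f f' hf h0
    refine monotoneOn_of_hasDerivWithinAt_nonneg (convex_Icc _ _)
      (fun t _ => (hf t).continuousAt.continuousWithinAt)
      (fun t _ => (hf t).hasDerivWithinAt) (fun t ht => h0 t (interior_subset ht))
  have m0 : (0:ℝ) ∈ Icc 0 tstar := ⟨le_rfl, htstar.le⟩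
  have m1 : tstar ∈ Icc 0 tstar := ⟨htstar.le, le_rfl⟩
  have hA := key _ _ (fun t => ((hasDerivAt_id t).const_mul (κ₂ * ‖v‖ ^ 2)).sub (hl' t))
    (fun t ht => by have := (hhess t ht).2; linarith) m0 m1 htstar.le
  have hB : ∀ t ∈ Icc 0 tstar,
      ⟪v, gradient U (x + t • v)⟫ ≤ -(κ₁ * ‖v‖ ^ 2) * (tstar - t) := by
    intro t ht
    have h := key _ _ (fun t => (hl' t).sub ((hasDerivAt_id t).const_mul (κ₁ * ‖v‖ ^ 2)))
      (fun t ht => by have := (hhess t ht).1; linarith) ht m1 ht.2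
    simp only [Pi.sub_apply, id, hlamstar] at h
    linarith
  simp only [Pi.sub_apply, id, hlamstar, zero_smul, add_zero] at hA
  have ha : -(⟪v, gradient U x⟫) / (κ₂ * ‖v‖ ^ 2) ≤ tstar := by
    rw [div_le_iff₀ (by positivity)]
    linarith
  have hb : ∀ t ∈ Icc 0 tstar, U (x + t • v) - U x ≤ -(κ₁ / 2) * ‖v‖ ^ 2 * t ^ 2 := by
    intro t ht
    have hq : ∀ t : ℝ, HasDerivAt (fun s : ℝ => -(κ₁ * ‖v‖ ^ 2) * (tstar * s - s ^ 2 / 2))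
        (-(κ₁ * ‖v‖ ^ 2) * (tstar - t)) t := by
      intro t
      have h := (((hasDerivAt_id t).const_mul tstar).sub
        (((hasDerivAt_id t).pow 2).div_const 2)).const_mul (-(κ₁ * ‖v‖ ^ 2))
      refine h.congr_deriv ?_
      simp
    have h := key _ _ (fun t => (hq t).sub (hU' t))
      (fun t ht => by have := hB t ht; linarith) m0 ht ht.1
    simp only [Pi.sub_apply, zero_smul, add_zero] at h
    have h3 : 0 ≤ (κ₁ * ‖v‖ ^ 2) * (t * (tstar - t)) :=
      mul_nonneg (by positivity) (mul_nonneg ht.1 (sub_nonneg.mpr ht.2))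
    nlinarith
  refine ⟨ha, hb, (hb tstar m1).trans ?_⟩
  have h0 : 0 ≤ -(⟪v, gradient U x⟫) / (κ₂ * ‖v‖ ^ 2) :=
    div_nonneg (by linarith) (by positivity)
  have hsq := mul_le_mul_of_nonneg_left (pow_le_pow_left₀ h0 ha 2)
    (show 0 ≤ κ₁ / 2 * ‖v‖ ^ 2 by positivity)
  have he : -(κ₁ / (2 * κ₂ ^ 2)) * ⟪v, gradient U x⟫ ^ 2 / ‖v‖ ^ 2 =
      -(κ₁ / 2 * ‖v‖ ^ 2 * (-(⟪v, gradient U x⟫) / (κ₂ * ‖v‖ ^ 2)) ^ 2) := by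
    have := hn.ne'
    have := norm_ne_zero_iff.mpr hv
    field_simp
  rw [he]
  linarith
end

section
/- Let U : ℝᴺ → ℝ be twice continuously differentiable, T > 0, and let x, v : [0,T] → ℝᴺ be differentiable functions satisfying, for all t ∈ [0,T], x′(t) = v(t) and v′(t) = −(⟨v(t), ∇²U(x(t)) v(t)⟩ / ‖∇U(x(t))‖²) · ∇U(x(t)), where ∇U(x(t)) ≠ 0 for all t ∈ [0,T]. Then the function t ↦ ⟨v(t), ∇U(x(t))⟩ is constant on [0,T]; moreover, if ⟨v(0), ∇U(x(0))⟩ = 0, then U(x(t)) = U(x(0)) and ‖v(t)‖ = ‖v(0)‖ for all t ∈ [0,T]. -/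
open Set
open scoped RealInnerProductSpace

theorem stmt9 (N : ℕ) (U : EuclideanSpace ℝ (Fin N) → ℝ) (hU : ContDiff ℝ 2 U)
    (T : ℝ) (hT : 0 < T)
    (x v : ℝ → EuclideanSpace ℝ (Fin N))
    (hgrad : ∀ t ∈ Set.Icc 0 T, gradient U (x t) ≠ 0)
    (hx : ∀ t ∈ Set.Icc 0 T, HasDerivAt x (v t) t)
    (hv : ∀ t ∈ Set.Icc 0 T, HasDerivAt v
      (-(⟪v t, fderiv ℝ (gradient U) (x t) (v t)⟫ / ‖gradient U (x t)‖ ^ 2) •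
        gradient U (x t)) t) :
    (∀ t ∈ Set.Icc 0 T, ⟪v t, gradient U (x t)⟫ = ⟪v 0, gradient U (x 0)⟫) ∧
    (⟪v 0, gradient U (x 0)⟫ = 0 →
      ∀ t ∈ Set.Icc 0 T, U (x t) = U (x 0) ∧ ‖v t‖ = ‖v 0‖) := by
  have hconst : ∀ f : ℝ → ℝ, (∀ t ∈ Set.Icc 0 T, HasDerivAt f 0 t) →
      ∀ t ∈ Set.Icc 0 T, f t = f 0 := by
    intro f hf
    exact constant_of_has_deriv_right_zero
      (fun t ht => (hf t ht).continuousAt.continuousWithinAt)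
      (fun t ht => (hf t ⟨ht.1, ht.2.le⟩).hasDerivWithinAt)
  have hgd : Differentiable ℝ (gradient U) := by
    have h1 : Differentiable ℝ (fderiv ℝ U) :=
      (hU.fderiv_right (m := 1) (by norm_num)).differentiable (by norm_num)
    intro y
    exact ((InnerProductSpace.toDual ℝ
      (EuclideanSpace ℝ (Fin N))).symm.toContinuousLinearEquiv.differentiableAt).comp y (h1 y)
  have hUd : Differentiable ℝ U := hU.differentiable (by norm_num)
  have key : ∀ t ∈ Set.Icc 0 T, ⟪v t, gradient U (x t)⟫ = ⟪v 0, gradient U (x 0)⟫ := by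
    refine hconst (fun t => ⟪v t, gradient U (x t)⟫) ?_
    intro t ht
    have hg : HasDerivAt (fun s => gradient U (x s))
        (fderiv ℝ (gradient U) (x t) (v t)) t :=
      (hgd (x t)).hasFDerivAt.comp_hasDerivAt t (hx t ht)
    have h := (hv t ht).inner ℝ hg
    have hne : ‖gradient U (x t)‖ ^ 2 ≠ 0 := pow_ne_zero _ (norm_ne_zero_iff.mpr (hgrad t ht))
    refine HasDerivAt.congr_deriv h ?_
    rw [real_inner_smul_left, real_inner_self_eq_norm_sq]
    rw [neg_mul, div_mul_cancel₀ _ hne, add_neg_cancel]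
  refine ⟨key, fun h0 t ht => ⟨?_, ?_⟩⟩
  · refine hconst (fun t => U (x t)) ?_ t ht
    intro s hs
    have h := (hUd (x s)).hasGradientAt.hasFDerivAt.comp_hasDerivAt s (hx s hs)
    refine HasDerivAt.congr_deriv h ?_
    rw [InnerProductSpace.toDual_apply_apply, real_inner_comm, key s hs, h0]
  · have h2 : ⟪v t, v t⟫ = ⟪v 0, v 0⟫ := by
      refine hconst (fun t => ⟪v t, v t⟫) ?_ t ht
      intro s hs
      have h := (hv s hs).inner ℝ (hv s hs)
      refine HasDerivAt.congr_deriv h ?_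
      have hk : ⟪gradient U (x s), v s⟫ = 0 := by rw [real_inner_comm, key s hs, h0]
      rw [real_inner_smul_left, real_inner_smul_right, hk, key s hs, h0]; simp
    rw [real_inner_self_eq_norm_sq, real_inner_self_eq_norm_sq] at h2
    exact (sq_eq_sq₀ (norm_nonneg _) (norm_nonneg _)).mp h2
end

section
/- Let N ≥ 1 and let g ∈ ℝᴺ with g ≠ 0. Define p_n = |g_n| / Σ_{m=1}^N |g_m| and q_n = g_n² / Σ_{m=1}^N g_m². Then for all constants c > 0 and γ > 0, Σ_{n=1}^N p_n · exp(−min{c·q_n, γ/2}) ≤ 1 − (1/N)·(1 − exp(−min{c/N, γ/2})). -/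
open Finset

theorem stmt10 (N : ℕ) (hN : 1 ≤ N) (g : Fin N → ℝ) (hg : g ≠ 0)
    (c γ : ℝ) (hc : 0 < c) (hγ : 0 < γ) :
    ∑ n : Fin N, (|g n| / ∑ m : Fin N, |g m|) *
        Real.exp (-min (c * (g n ^ 2 / ∑ m : Fin N, g m ^ 2)) (γ / 2)) ≤
      1 - (1 / (N : ℝ)) * (1 - Real.exp (-min (c / (N : ℝ)) (γ / 2))) := by
  have hNpos : (0 : ℝ) < N := by exact_mod_cast hN
  obtain ⟨j, hj⟩ : ∃ j, g j ≠ 0 := by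
    by_contra h
    push Not at h
    exact hg (funext h)
  have hS : 0 < ∑ m : Fin N, |g m| :=
    Finset.sum_pos' (fun i _ => abs_nonneg _) ⟨j, mem_univ _, abs_pos.mpr hj⟩
  have hQ : 0 < ∑ m : Fin N, g m ^ 2 :=
    Finset.sum_pos' (fun i _ => sq_nonneg _) ⟨j, mem_univ _, by positivity⟩
  obtain ⟨M, -, hM⟩ := Finset.exists_max_image univ (fun n => |g n|) ⟨j, mem_univ _⟩
  have hp : 1 / (N : ℝ) ≤ |g M| / ∑ m : Fin N, |g m| := by
    rw [div_le_div_iff₀ hNpos hS]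
    have := Finset.sum_le_card_nsmul univ (fun n => |g n|) (|g M|) hM
    simp at this
    linarith
  have hq : 1 / (N : ℝ) ≤ g M ^ 2 / ∑ m : Fin N, g m ^ 2 := by
    rw [div_le_div_iff₀ hNpos hQ]
    have := Finset.sum_le_card_nsmul univ (fun n => g n ^ 2) (g M ^ 2)
      (fun n hn => sq_le_sq.mpr (hM n hn))
    simp at this
    linarith
  have hsum : ∑ n : Fin N, (|g n| / ∑ m : Fin N, |g m|) = 1 := by
    rw [← Finset.sum_div, div_self hS.ne']
  have hterm : ∀ n : Fin N, 0 ≤ (|g n| / ∑ m : Fin N, |g m|) *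
      (1 - Real.exp (-min (c * (g n ^ 2 / ∑ m : Fin N, g m ^ 2)) (γ / 2))) := by
    intro n
    apply mul_nonneg (by positivity)
    rw [sub_nonneg, Real.exp_le_one_iff, neg_nonpos]
    exact le_min (by positivity) (by positivity)
  have h1 := Finset.single_le_sum (fun n _ => hterm n) (mem_univ M)
  have h2 : (1 / (N : ℝ)) * (1 - Real.exp (-min (c / (N : ℝ)) (γ / 2))) ≤
      (|g M| / ∑ m : Fin N, |g m|) *
      (1 - Real.exp (-min (c * (g M ^ 2 / ∑ m : Fin N, g m ^ 2)) (γ / 2))) := by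
    apply mul_le_mul hp _ _ (by positivity)
    · apply sub_le_sub_left
      apply Real.exp_le_exp.mpr
      apply neg_le_neg
      apply min_le_min_right
      rw [div_eq_mul_one_div]
      exact mul_le_mul_of_nonneg_left hq hc.le
    · rw [sub_nonneg, Real.exp_le_one_iff, neg_nonpos]
      exact le_min (by positivity) (by positivity)
  have h3 := h2.trans h1
  simp only [mul_sub, mul_one, Finset.sum_sub_distrib, hsum] at h3 ⊢
  linarith
end

section
/- Let N ≥ 1, let H be a real N×N matrix, let K ⊆ {1,…,N} and J = {1,…,N} \ K. Assume the diagonal-dominance condition H_{kk} − Σ_{l≠k} |H_{kl}| > 0 for every k ∈ K. Then for every family (v_j)_{j∈J} of reals with |v_j| ≤ 1 for all j ∈ J, there is exactly one family (v_k)_{k∈K} of reals satisfying Σ_{l=1}^N H_{kl} v_l = 0 for all k ∈ K, and this solution satisfies |v_k| < 1 for every k ∈ K. -/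
open Finset

theorem stmt15 (N : ℕ) (hN : 1 ≤ N) (H : Matrix (Fin N) (Fin N) ℝ)
    (K : Finset (Fin N))
    (hdd : ∀ k ∈ K, ∑ l ∈ Finset.univ.erase k, |H k l| < H k k)
    (v : Fin N → ℝ) (hv : ∀ j ∉ K, |v j| ≤ 1) :
    (∃! u : Fin N → ℝ, (∀ j ∉ K, u j = v j) ∧ ∀ k ∈ K, ∑ l, H k l * u l = 0) ∧
    (∀ u : Fin N → ℝ, ((∀ j ∉ K, u j = v j) ∧ ∀ k ∈ K, ∑ l, H k l * u l = 0) →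
      ∀ k ∈ K, |u k| < 1) := by
  constructor
  · let M : Matrix (Fin N) (Fin N) ℝ :=
      fun k l => if k ∈ K then H k l else (1 : Matrix (Fin N) (Fin N) ℝ) k l
    let b : Fin N → ℝ := fun k => if k ∈ K then 0 else v k
    have hdet : M.det ≠ 0 := by
      apply det_ne_zero_of_sum_row_lt_diag
      intro k
      by_cases hk : k ∈ K
      · simp only [M, hk, if_true, Real.norm_eq_abs]
        exact (hdd k hk).trans_le (le_abs_self _)
      · have h0 : ∑ j ∈ Finset.univ.erase k, ‖M k j‖ = 0 := by
          apply Finset.sum_eq_zero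
          intro j hj
          have : k ≠ j := (Finset.ne_of_mem_erase hj).symm
          simp [M, hk, Matrix.one_apply_ne this]
        rw [h0]
        simp [M, hk]
    have hu : IsUnit M.det := isUnit_iff_ne_zero.mpr hdet
    have key : ∀ u : Fin N → ℝ,
        ((∀ j ∉ K, u j = v j) ∧ ∀ k ∈ K, ∑ l, H k l * u l = 0) ↔ M.mulVec u = b := by
      intro u
      have hin : ∀ k ∈ K, M.mulVec u k = ∑ l, H k l * u l := by
        intro k hk
        simp [M, Matrix.mulVec, dotProduct, hk]
      have hout : ∀ k ∉ K, M.mulVec u k = u k := by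
        intro k hk
        simp [M, Matrix.mulVec, dotProduct, hk, Matrix.one_apply]
      constructor
      · rintro ⟨h1, h2⟩
        funext k
        by_cases hk : k ∈ K
        · rw [hin k hk, h2 k hk]; simp [b, hk]
        · rw [hout k hk, h1 k hk]; simp [b, hk]
      · intro h
        constructor
        · intro k hk
          rw [← hout k hk, h]; simp [b, hk]
        · intro k hk
          rw [← hin k hk, h]; simp [b, hk]
    refine ⟨M⁻¹.mulVec b, (key _).2 ?_, ?_⟩
    · rw [Matrix.mulVec_mulVec, Matrix.mul_nonsing_inv _ hu, Matrix.one_mulVec]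
    · intro y hy
      rw [← (key y).1 hy, Matrix.mulVec_mulVec, Matrix.nonsing_inv_mul _ hu, Matrix.one_mulVec]
  · rintro u ⟨h1, h2⟩ k0 hk0
    obtain ⟨k, hk, hmax⟩ := Finset.exists_max_image K (fun k => |u k|) ⟨k0, hk0⟩
    refine (hmax k0 hk0).trans_lt ?_
    by_contra! hge
    have hall : ∀ l, |u l| ≤ |u k| := by
      intro l
      by_cases hl : l ∈ K
      · exact hmax l hl
      · rw [h1 l hl]; exact (hv l hl).trans hge
    have hs := h2 k hk
    rw [← Finset.add_sum_erase _ _ (Finset.mem_univ k)] at hs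
    have e1 : H k k * |u k| ≤ |H k k * u k| := by
      rw [abs_mul]
      exact mul_le_mul_of_nonneg_right (le_abs_self _) (abs_nonneg _)
    have e2 : |H k k * u k| = |∑ l ∈ Finset.univ.erase k, H k l * u l| := by
      rw [eq_neg_of_add_eq_zero_left hs, abs_neg]
    have e3 : |∑ l ∈ Finset.univ.erase k, H k l * u l|
        ≤ (∑ l ∈ Finset.univ.erase k, |H k l|) * |u k| := by
      rw [Finset.sum_mul]
      refine (Finset.abs_sum_le_sum_abs _ _).trans (Finset.sum_le_sum fun l _ => ?_)
      rw [abs_mul]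
      exact mul_le_mul_of_nonneg_left (hall l) (abs_nonneg _)
    have e4 := mul_lt_mul_of_pos_right (hdd k hk) (zero_lt_one.trans_le hge)
    linarith
end

section
/- Let U : ℝᴺ → ℝ be continuously differentiable, convex, and coercive (U(x) → ∞ as ‖x‖ → ∞). Let x ∈ ℝᴺ and v ∈ ℝᴺ with v ≠ 0 and ⟨v, ∇U(x)⟩ < 0. Then the tangency time t(x,v) := inf{ t > 0 : ⟨v, ∇U(x + t v)⟩ = 0 } is finite, and ⟨v, ∇U(x + t(x,v)·v)⟩ = 0. -/
open Set Filter
open scoped RealInnerProductSpace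

theorem stmt18 (N : ℕ) (U : EuclideanSpace ℝ (Fin N) → ℝ) (hU : ContDiff ℝ 1 U)
    (hconv : ConvexOn ℝ Set.univ U)
    (hcoer : Filter.Tendsto U (Filter.cocompact (EuclideanSpace ℝ (Fin N))) Filter.atTop)
    (x v : EuclideanSpace ℝ (Fin N)) (hv : v ≠ 0)
    (hneg : ⟪v, gradient U x⟫ < 0) :
    {t : ℝ | 0 < t ∧ ⟪v, gradient U (x + t • v)⟫ = 0}.Nonempty ∧
    ⟪v, gradient U
        (x + (sInf {t : ℝ | 0 < t ∧ ⟪v, gradient U (x + t • v)⟫ = 0}) • v)⟫ = 0 := by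
  have hform : ∀ y, ⟪v, gradient U y⟫ = fderiv ℝ U y v := by
    intro y
    rw [real_inner_comm]
    simp [gradient]
  simp only [hform] at hneg ⊢
  have hline : Continuous (fun t : ℝ => x + t • v) := by fun_prop
  have hg : Continuous (fun t : ℝ => fderiv ℝ U (x + t • v) v) :=
    ((hU.continuous_fderiv one_ne_zero).comp hline).clm_apply continuous_const
  have hder : ∀ t : ℝ, HasDerivAt (fun t : ℝ => U (x + t • v)) (fderiv ℝ U (x + t • v) v) t := by
    intro t
    have h1 : HasDerivAt (fun t : ℝ => x + t • v) v t := by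
      simpa using ((hasDerivAt_id t).smul_const v).const_add x
    exact ((hU.differentiable one_ne_zero) (x + t • v)).hasFDerivAt.comp_hasDerivAt t h1
  have hg0 : fderiv ℝ U (x + (0 : ℝ) • v) v < 0 := by simpa using hneg
  have hne : {t : ℝ | 0 < t ∧ fderiv ℝ U (x + t • v) v = 0}.Nonempty := by
    by_contra hcon
    have hlt : ∀ t : ℝ, 0 ≤ t → fderiv ℝ U (x + t • v) v < 0 := by
      intro t ht
      by_contra hge
      push Not at hge
      obtain ⟨s, hs, hs0⟩ := intermediate_value_Icc ht hg.continuousOn ⟨hg0.le, hge⟩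
      have hs0 : fderiv ℝ U (x + s • v) v = 0 := hs0
      refine hcon ⟨s, lt_of_le_of_ne hs.1 ?_, hs0⟩
      rintro rfl
      exact hg0.ne hs0
    have hanti : AntitoneOn (fun t : ℝ => U (x + t • v)) (Ici 0) := by
      apply antitoneOn_of_deriv_nonpos (convex_Ici 0)
      · exact (hU.continuous.comp hline).continuousOn
      · intro t _
        exact (hder t).differentiableAt.differentiableWithinAt
      · intro t ht
        rw [interior_Ici] at ht
        rw [(hder t).deriv]
        exact (hlt t (le_of_lt ht)).le
    have hto : Tendsto (fun t : ℝ => x + t • v) atTop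
        (cocompact (EuclideanSpace ℝ (Fin N))) := by
      apply tendsto_cocompact_of_tendsto_dist_comp_atTop x
      have : Tendsto (fun t : ℝ => |t| * ‖v‖) atTop atTop :=
        tendsto_abs_atTop_atTop.atTop_mul_const (norm_pos_iff.2 hv)
      simpa [dist_eq_norm, norm_smul] using this
    obtain ⟨t, ht, ht0⟩ := (((hcoer.comp hto).eventually_gt_atTop (U (x + (0 : ℝ) • v))).and
      (eventually_ge_atTop 0)).exists
    exact absurd (hanti self_mem_Ici ht0 ht0) (not_le.2 ht)
  refine ⟨hne, ?_⟩
  have heq : {t : ℝ | 0 < t ∧ fderiv ℝ U (x + t • v) v = 0}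
      = {t : ℝ | 0 ≤ t ∧ fderiv ℝ U (x + t • v) v = 0} := by
    ext t
    refine ⟨fun h => ⟨h.1.le, h.2⟩, fun h => ⟨lt_of_le_of_ne h.1 ?_, h.2⟩⟩
    rintro rfl
    exact hg0.ne h.2
  rw [heq] at hne ⊢
  have hcl : IsClosed {t : ℝ | 0 ≤ t ∧ fderiv ℝ U (x + t • v) v = 0} :=
    (isClosed_le continuous_const continuous_id).inter (isClosed_eq hg continuous_const)
  exact (hcl.csInf_mem hne ⟨0, fun t h => h.1⟩).2
end
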